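/- Identify subsets of ℕ with points of the product space K = {0,1}^ℕ endowed with the product topology, and let T = {A ⊆ ℕ : r_n(A) ≥ 1 for every n} with the subspace topology. For each integer q > 0, the set V(q) = {A ∈ T : there exists m with r_m(A) ≥ q} is open in T, and the set V = {A ∈ T : the sequence (r_n(A))_{n∈ℕ} is unbounded} is dense in T. -/

import Mathlib

/-- The number of `A`-representations of `n`: ordered pairs `(x, y) ∈ A × A` with `x + y = n`. -/
noncomputable def rCount (A : Set ℕ) (n : ℕ) : ℕ :=
  Set.ncard {q : ℕ × ℕ | q.1 ∈ A ∧ q.2 ∈ A ∧ q.1 + q.2 = n}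

/-- Representation numbers for a point of the product space `{0,1}^ℕ = (ℕ → Bool)`,
identifying `ω` with the subset `{n | ω n = true}` of `ℕ`. -/
noncomputable def rCountB (ω : ℕ → Bool) (n : ℕ) : ℕ :=
  rCount {m : ℕ | ω m = true} n

/-- The space of bases of `ℕ`, as a subset of the product space `(ℕ → Bool)`
(with the product topology of the discrete two-point space). -/
def basisSpace : Set (ℕ → Bool) := {ω | ∀ n : ℕ, 1 ≤ rCountB ω n}

/-- `rCountB` as a finite sum over the antidiagonal. -/
theorem rCountB_eq_sum (ω : ℕ → Bool) (n : ℕ) :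
    rCountB ω n = ∑ p ∈ Finset.HasAntidiagonal.antidiagonal n, (ω p.1 && ω p.2).toNat := by
  have hset : {q : ℕ × ℕ | q.1 ∈ {m : ℕ | ω m = true} ∧ q.2 ∈ {m : ℕ | ω m = true} ∧
      q.1 + q.2 = n} =
      ((Finset.HasAntidiagonal.antidiagonal n).filter fun p => (ω p.1 && ω p.2) = true :
        Finset (ℕ × ℕ)) := by
    ext p
    simp [and_comm, and_assoc]
  rw [rCountB, rCount, hset, Set.ncard_coe_finset, Finset.card_filter]
  refine Finset.sum_congr rfl fun p _ => ?_
  cases ω p.1 <;> cases ω p.2 <;> rfl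

theorem continuous_rCountB (n : ℕ) : Continuous fun ω : ℕ → Bool => rCountB ω n := by
  simp only [rCountB_eq_sum]
  refine continuous_finsetSum _ fun p _ => ?_
  have h : Continuous fun b : Bool × Bool => (b.1 && b.2).toNat := continuous_of_discreteTopology
  exact h.comp (g := fun b : Bool × Bool => (b.1 && b.2).toNat)
    (f := fun ω : ℕ → Bool => (ω p.1, ω p.2))
    ((continuous_apply p.1).prodMk (continuous_apply p.2))

theorem rCountB_mono {ω ω' : ℕ → Bool} (h : ∀ n, ω n = true → ω' n = true) (n : ℕ) :
    rCountB ω n ≤ rCountB ω' n := by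
  simp only [rCountB_eq_sum]
  refine Finset.sum_le_sum fun p _ => ?_
  have h₁ := h p.1
  have h₂ := h p.2
  cases hx : ω p.1 <;> cases hy : ω p.2 <;> simp_all

/-- The set `ω` together with all integers `≥ N`. -/
def addTail (ω : ℕ → Bool) (N : ℕ) : ℕ → Bool := fun n => ω n || decide (N ≤ n)

theorem addTail_mem_basisSpace {ω : ℕ → Bool} (h : ω ∈ basisSpace) (N : ℕ) :
    addTail ω N ∈ basisSpace := fun n =>
  (h n).trans (rCountB_mono (fun m hm => by simp [addTail, hm]) n)

theorem lt_rCountB_addTail (ω : ℕ → Bool) (N k : ℕ) :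
    k < rCountB (addTail ω N) (2 * N + k) := by
  have hsub : (Finset.range (k + 1)).image (fun i => (N + i, N + (k - i))) ⊆
      Finset.HasAntidiagonal.antidiagonal (2 * N + k) := by
    intro p hp
    obtain ⟨i, hi, rfl⟩ := Finset.mem_image.1 hp
    simp only [Finset.mem_range] at hi
    refine Finset.HasAntidiagonal.mem_antidiagonal.2 ?_
    dsimp only
    omega
  have hinj : Set.InjOn (fun i => (N + i, N + (k - i))) (Finset.range (k + 1) : Set ℕ) := by
    intro i _ j _ hij
    simpa using congrArg Prod.fst hij
  rw [rCountB_eq_sum]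
  refine lt_of_lt_of_le ?_ (Finset.sum_le_sum_of_subset hsub)
  rw [Finset.sum_image hinj]
  simp [addTail]

open Filter Topology in
theorem tendsto_addTail (ω : ℕ → Bool) : Tendsto (addTail ω) atTop (𝓝 ω) := by
  refine tendsto_pi_nhds.2 fun n => tendsto_const_nhds.congr' ?_
  filter_upwards [eventually_gt_atTop n] with N hN
  simp [addTail, hN]

/-- In the space `T` of bases of `ℕ`: for each integer `q > 0` the set
`V(q) = {A ∈ T | ∃ m, r_m(A) ≥ q}` is open in `T`, and the set of bases with unbounded
representation-number sequence is dense in `T`. -/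
theorem stmt_16 :
    (∀ q : ℕ, 0 < q →
      IsOpen {A : basisSpace | ∃ m : ℕ, q ≤ rCountB (A : ℕ → Bool) m}) ∧
    Dense {A : basisSpace | ¬∃ B : ℕ, ∀ n : ℕ, rCountB (A : ℕ → Bool) n ≤ B} := by
  refine ⟨fun q _ => ?_, fun A => ?_⟩
  · rw [Set.ofPred_exists]
    exact isOpen_iUnion fun m =>
      (isOpen_discrete (Set.Ici q)).preimage ((continuous_rCountB m).comp continuous_subtype_val)
  · refine mem_closure_of_tendsto
      (f := fun N => (⟨addTail A N, addTail_mem_basisSpace A.2 N⟩ : basisSpace))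
      (tendsto_subtype_rng.2 (tendsto_addTail A)) (Filter.Eventually.of_forall ?_)
    rintro N ⟨B, hB⟩
    exact (lt_rCountB_addTail A N B).not_ge (hB _)
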